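/- arXiv:1905.04057 — 2 statements merged into one kernel-verified Lean document; each statement's English description precedes it below -/
import Mathlib

section
/- Let 0 < R ≤ 1, M ≥ 0, σ > 0 and η > 0. Let ρ_r be an even 2-periodic probability density that is square integrable on [-1,1], and let ρˢ be a twice continuously differentiable even 2-periodic probability density solving the stationary Fokker–Planck equation (σ²/2) (ρˢ)''(x) + d/dx (ρˢ(x) G_{ρˢ}(x)) = 0 for all x ∈ ℝ. Set σ_b² = (4R/π)(M + R/√3 + 2) and c_b = 4R²M/(π√3). If σ² > σ_b² + η c_b, then (∫_{-1}^{1} (ρˢ(x) − 1)² dx)^{1/2} ≤ (1/η) (∫_{-1}^{1} ρ_r(x)² dx)^{1/2}. -/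
open MeasureTheory Real

/-- The influence field `G_ρ(x) = ∫_{x-R}^{x+R} (x-y)(ρ(y) + M ρ_r(y)) dy`. -/
noncomputable def G (R M : ℝ) (ρ ρr : ℝ → ℝ) (x : ℝ) : ℝ :=
  ∫ y in (x - R)..(x + R), (x - y) * (ρ y + M * ρr y)

/-- `f` is an even 2-periodic probability density. -/
def IsEvenPeriodicDensity (f : ℝ → ℝ) : Prop :=
  (∀ x, f (x + 2) = f x) ∧ (∀ x, f (-x) = f x) ∧ (∀ x, 0 ≤ f x) ∧
    (∫ x in (0:ℝ)..1, f x) = 1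

theorem sq_intervalIntegral_mul_le {f g : ℝ → ℝ} {a b : ℝ} (hab : a ≤ b)
    (hf : IntervalIntegrable (fun x => f x ^ 2) volume a b)
    (hg : IntervalIntegrable (fun x => g x ^ 2) volume a b)
    (hfg : IntervalIntegrable (fun x => f x * g x) volume a b) :
    (∫ x in a..b, f x * g x) ^ 2 ≤ (∫ x in a..b, f x ^ 2) * ∫ x in a..b, g x ^ 2 := by
  have key : ∀ t : ℝ, 0 ≤ (∫ x in a..b, g x ^ 2) * (t * t)
      + (-2 * ∫ x in a..b, f x * g x) * t + ∫ x in a..b, f x ^ 2 := by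
    intro t
    have h : 0 ≤ ∫ x in a..b, (f x - t * g x) ^ 2 :=
      intervalIntegral.integral_nonneg hab fun x _ => sq_nonneg _
    have e : (fun x => (f x - t * g x) ^ 2)
        = fun x => (t * t) * g x ^ 2 + (-2 * t) * (f x * g x) + f x ^ 2 := by
      ext x; ring
    rw [e, intervalIntegral.integral_add ((hg.const_mul _).add (hfg.const_mul _)) hf,
      intervalIntegral.integral_add (hg.const_mul _) (hfg.const_mul _),
      intervalIntegral.integral_const_mul, intervalIntegral.integral_const_mul] at h
    linarith
  have := discrim_le_zero key
  unfold discrim at this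
  linarith

theorem abs_intervalIntegral_mul_le {f g : ℝ → ℝ} {a b : ℝ} (hab : a ≤ b)
    (hf : Continuous f) (hg : Continuous g) :
    |∫ x in a..b, f x * g x| ≤ √(∫ x in a..b, f x ^ 2) * √(∫ x in a..b, g x ^ 2) := by
  rw [← Real.sqrt_mul (intervalIntegral.integral_nonneg hab fun x _ => sq_nonneg _)]
  exact Real.abs_le_sqrt (sq_intervalIntegral_mul_le hab ((hf.pow 2).intervalIntegrable _ _)
    ((hg.pow 2).intervalIntegrable _ _) ((hf.mul hg).intervalIntegrable _ _))

theorem two_mul_mul_one_sub_le_sin {x : ℝ} (h0 : 0 ≤ x) (h1 : x ≤ 1) :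
    2 * (x * (1 - x)) ≤ sin (π * x) := by
  have aux : ∀ y : ℝ, 0 ≤ y → y ≤ 1 / 2 → 2 * (y * (1 - y)) ≤ sin (π * y) := by
    intro y hy0 hy1
    have h := Real.mul_le_sin (x := π * y) (by positivity) (by nlinarith [Real.pi_pos])
    have e : 2 / π * (π * y) = 2 * y := by field_simp
    nlinarith
  rcases le_total x (1 / 2) with h | h
  · exact aux x h0 h
  · have h2 := aux (1 - x) (by linarith) (by linarith)
    have e : π * (1 - x) = π - π * x := by ring
    rw [e, Real.sin_pi_sub] at h2
    linarith

theorem continuousOn_cos_mul_sq_div_sin {f f' : ℝ → ℝ} (hf : ∀ x, HasDerivAt f (f' x) x)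
    (hf' : Continuous f') (h0 : f 0 = 0) (h1 : f 1 = 0) :
    ContinuousOn (fun x => cos (π * x) * f x ^ 2 / sin (π * x)) (Set.Icc 0 1) := by
  obtain ⟨C, hC⟩ := isCompact_Icc.exists_bound_of_continuousOn
    (hf'.continuousOn (s := Set.Icc (0 : ℝ) 1))
  have hlip : ∀ x ∈ Set.Icc (0 : ℝ) 1, ∀ y ∈ Set.Icc (0 : ℝ) 1, ‖f y - f x‖ ≤ C * ‖y - x‖ :=
    fun x hx y hy => (convex_Icc (0 : ℝ) 1).norm_image_sub_le_of_norm_hasDerivWithin_le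
      (fun z _ => (hf z).hasDerivWithinAt) hC hx hy
  have hb : ∀ x ∈ Set.Icc (0 : ℝ) 1,
      ‖cos (π * x) * f x ^ 2 / sin (π * x)‖ ≤ 2 * C ^ 2 * (x * (1 - x)) := by
    intro x hx
    have hx0 := hx.1
    have hx1 := hx.2
    have hl := hlip 0 (by simp) x hx
    have hr := hlip 1 (by simp) x hx
    have hCn : 0 ≤ C := (norm_nonneg _).trans (hC x hx)
    rw [h0, Real.norm_eq_abs, Real.norm_eq_abs, sub_zero, sub_zero, abs_of_nonneg hx0] at hl
    rw [h1, Real.norm_eq_abs, Real.norm_eq_abs, sub_zero, abs_sub_comm x 1,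
      abs_of_nonneg (sub_nonneg.2 hx1)] at hr
    have hs := two_mul_mul_one_sub_le_sin hx0 hx1
    have hp : 0 ≤ x * (1 - x) := mul_nonneg hx0 (sub_nonneg.2 hx1)
    have hm : |f x| ≤ C * (2 * (x * (1 - x))) := by
      rcases le_total x (1 / 2) with h | h
      · exact hl.trans (mul_le_mul_of_nonneg_left (by nlinarith) hCn)
      · exact hr.trans (mul_le_mul_of_nonneg_left (by nlinarith) hCn)
    have hsq : f x ^ 2 ≤ (C * (2 * (x * (1 - x)))) ^ 2 := by
      rw [← sq_abs]; exact pow_le_pow_left₀ (abs_nonneg _) hm 2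
    rw [norm_div, norm_mul, Real.norm_eq_abs, Real.norm_eq_abs, Real.norm_eq_abs,
      abs_of_nonneg (sq_nonneg (f x)), abs_of_nonneg (a := sin (π * x)) (by linarith)]
    refine div_le_of_le_mul₀ (by linarith) (by positivity) ?_
    calc |cos (π * x)| * f x ^ 2 ≤ 1 * (C * (2 * (x * (1 - x)))) ^ 2 := by
          gcongr
          exact Real.abs_cos_le_one _
      _ = 2 * C ^ 2 * (x * (1 - x)) * (2 * (x * (1 - x))) := by ring
      _ ≤ _ := by gcongr
  have hfc : Continuous f := continuous_iff_continuousAt.2 fun x => (hf x).continuousAt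
  intro x hx
  rcases eq_or_ne (x * (1 - x)) 0 with h | h
  · have hz : cos (π * x) * f x ^ 2 / sin (π * x) = 0 := by
      have := hb x hx
      rw [h, mul_zero] at this
      exact norm_le_zero_iff.1 this
    rw [ContinuousWithinAt, hz]
    refine squeeze_zero_norm' (a := fun x => 2 * C ^ 2 * (x * (1 - x)))
      (eventually_nhdsWithin_of_forall hb) ?_
    have hc : Continuous fun x : ℝ => 2 * C ^ 2 * (x * (1 - x)) := by fun_prop
    have ht := (hc.tendsto x).mono_left (nhdsWithin_le_nhds (s := Set.Icc (0 : ℝ) 1))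
    simpa only [h, mul_zero] using ht
  · have hp : 0 < x * (1 - x) :=
      lt_of_le_of_ne (mul_nonneg hx.1 (sub_nonneg.2 hx.2)) h.symm
    have hs := two_mul_mul_one_sub_le_sin hx.1 hx.2
    refine ContinuousAt.continuousWithinAt (ContinuousAt.div (by fun_prop) (by fun_prop) ?_)
    exact (by linarith : 0 < sin (π * x)).ne'

/-- Wirtinger's inequality with Dirichlet boundary conditions. -/
theorem pi_sq_mul_integral_sq_le_of_eq_zero {f f' : ℝ → ℝ} (hf : ∀ x, HasDerivAt f (f' x) x)
    (hf' : Continuous f') (h0 : f 0 = 0) (h1 : f 1 = 0) :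
    π ^ 2 * ∫ x in (0 : ℝ)..1, f x ^ 2 ≤ ∫ x in (0 : ℝ)..1, f' x ^ 2 := by
  have hfc : Continuous f := continuous_iff_continuousAt.2 fun x => (hf x).continuousAt
  have hc : Continuous fun x => f' x ^ 2 - π ^ 2 * f x ^ 2 := by fun_prop
  set F : ℝ → ℝ := fun x => (∫ t in (0 : ℝ)..x, (f' t ^ 2 - π ^ 2 * f t ^ 2))
    - π * (cos (π * x) * f x ^ 2 / sin (π * x)) with hF
  have hder : ∀ x ∈ Set.Ioo (0 : ℝ) 1,
      HasDerivAt F ((f' x - π * cos (π * x) / sin (π * x) * f x) ^ 2) x := by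
    intro x hx
    have hs : sin (π * x) ≠ 0 := by
      have := two_mul_mul_one_sub_le_sin hx.1.le hx.2.le
      have := mul_pos hx.1 (sub_pos.2 hx.2)
      exact (by linarith : 0 < sin (π * x)).ne'
    have hlin : HasDerivAt (fun x : ℝ => π * x) π x := by
      simpa using (hasDerivAt_id x).const_mul π
    have hi := intervalIntegral.integral_hasDerivAt_right (hc.intervalIntegrable 0 x)
      (hc.stronglyMeasurableAtFilter _ _) hc.continuousAt
    have := hi.sub (((hlin.cos.mul ((hf x).pow 2)).div hlin.sin hs).const_mul π)
    refine this.congr_deriv ?_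
    simp only [Pi.mul_apply, Pi.pow_apply]
    field_simp
    push_cast
    ring
  have hmono : MonotoneOn F (Set.Icc 0 1) := by
    refine monotoneOn_of_deriv_nonneg (convex_Icc 0 1) ?_ ?_ ?_
    · exact (intervalIntegral.continuous_primitive (fun a b => hc.intervalIntegrable a b)
        0).continuousOn.sub
        (continuousOn_const.mul (continuousOn_cos_mul_sq_div_sin hf hf' h0 h1))
    · rw [interior_Icc]
      exact fun x hx => (hder x hx).differentiableAt.differentiableWithinAt
    · rw [interior_Icc]
      intro x hx
      rw [(hder x hx).deriv]
      positivity
  have h := hmono (by simp) (by simp) zero_le_one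
  simp only [hF, h0, h1, intervalIntegral.integral_same] at h
  have hi : ∀ {g : ℝ → ℝ}, Continuous g → IntervalIntegrable (fun x => g x ^ 2) volume 0 1 :=
    fun hg => (hg.pow 2).intervalIntegrable _ _
  rw [intervalIntegral.integral_sub (hi hf') ((hi hfc).const_mul _),
    intervalIntegral.integral_const_mul] at h
  norm_num at h
  exact h

/-- Wirtinger's inequality for functions of mean zero. -/
theorem pi_sq_mul_integral_sq_le_of_integral_eq_zero {f f' : ℝ → ℝ}
    (hf : ∀ x, HasDerivAt f (f' x) x) (hf' : Continuous f')
    (hmean : ∫ x in (0 : ℝ)..1, f x = 0) :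
    π ^ 2 * ∫ x in (0 : ℝ)..1, f x ^ 2 ≤ ∫ x in (0 : ℝ)..1, f' x ^ 2 := by
  have hfc : Continuous f := continuous_iff_continuousAt.2 fun x => (hf x).continuousAt
  set F : ℝ → ℝ := fun x => ∫ t in (0 : ℝ)..x, f t with hF
  have hFd : ∀ x, HasDerivAt F (f x) x := fun x =>
    intervalIntegral.integral_hasDerivAt_right (hfc.intervalIntegrable 0 x)
      (hfc.stronglyMeasurableAtFilter _ _) hfc.continuousAt
  have hFc : Continuous F := continuous_iff_continuousAt.2 fun x => (hFd x).continuousAt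
  have hF0 : F 0 = 0 := intervalIntegral.integral_same
  have hF1 : F 1 = 0 := hmean
  have hdir := pi_sq_mul_integral_sq_le_of_eq_zero hFd hfc hF0 hF1
  have hparts := intervalIntegral.integral_mul_deriv_eq_deriv_mul (a := 0) (b := 1)
    (fun x _ => hf x) (fun x _ => hFd x) (hf'.intervalIntegrable _ _) (hfc.intervalIntegrable _ _)
  rw [hF0, hF1] at hparts
  have hcs := sq_intervalIntegral_mul_le zero_le_one ((hf'.pow 2).intervalIntegrable 0 1)
    ((hFc.pow 2).intervalIntegrable 0 1) ((hf'.mul hFc).intervalIntegrable 0 1)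
  have e : ∫ x in (0 : ℝ)..1, f x ^ 2 = -∫ x in (0 : ℝ)..1, f' x * F x := by
    simp only [sq]; rw [hparts]; ring
  have e2 : (∫ x in (0 : ℝ)..1, f x ^ 2) ^ 2 = (∫ x in (0 : ℝ)..1, f' x * F x) ^ 2 := by
    rw [e]; ring
  rw [← e2] at hcs
  have hnn : ∀ g : ℝ → ℝ, 0 ≤ ∫ x in (0 : ℝ)..1, g x ^ 2 := fun g =>
    intervalIntegral.integral_nonneg zero_le_one fun x _ => sq_nonneg _
  rcases (hnn f).eq_or_lt with h | h
  · rw [← h, mul_zero]; exact hnn f'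
  · refine le_of_mul_le_mul_right ?_ h
    calc π ^ 2 * (∫ x in (0 : ℝ)..1, f x ^ 2) * ∫ x in (0 : ℝ)..1, f x ^ 2
        = π ^ 2 * (∫ x in (0 : ℝ)..1, f x ^ 2) ^ 2 := by ring
      _ ≤ π ^ 2 * ((∫ x in (0 : ℝ)..1, f' x ^ 2) * ∫ x in (0 : ℝ)..1, F x ^ 2) := by gcongr
      _ = (∫ x in (0 : ℝ)..1, f' x ^ 2) * (π ^ 2 * ∫ x in (0 : ℝ)..1, F x ^ 2) := by ring
      _ ≤ _ := mul_le_mul_of_nonneg_left hdir (hnn f')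

theorem integral_neg_one_one_of_even {f : ℝ → ℝ} (heven : ∀ x, f (-x) = f x)
    (hf : IntervalIntegrable f volume (-1) 1) :
    ∫ x in (-1 : ℝ)..1, f x = 2 * ∫ x in (0 : ℝ)..1, f x := by
  have h := intervalIntegral.integral_comp_neg (a := 0) (b := 1) f
  simp only [heven, neg_zero] at h
  rw [← intervalIntegral.integral_add_adjacent_intervals (b := 0)
    (hf.mono_set (Set.uIcc_subset_uIcc (by simp) (by simp)))
    (hf.mono_set (Set.uIcc_subset_uIcc (by simp) (by simp))), ← h]
  ring

/-- The convolution of `f` with the bounded-confidence kernel. -/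
noncomputable def windowConv (R : ℝ) (f : ℝ → ℝ) (x : ℝ) : ℝ :=
  ∫ y in (x - R)..(x + R), (x - y) * f y

section windowConv

variable {R : ℝ} {f : ℝ → ℝ}

theorem windowConv_eq_primitive (hf : ∀ a b, IntervalIntegrable f volume a b) (x : ℝ) :
    windowConv R f x = x * ((∫ y in (0 : ℝ)..(x + R), f y) - ∫ y in (0 : ℝ)..(x - R), f y)
      - ((∫ y in (0 : ℝ)..(x + R), y * f y) - ∫ y in (0 : ℝ)..(x - R), y * f y) := by
  have hyf : ∀ a b, IntervalIntegrable (fun y => y * f y) volume a b := fun a b =>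
    (hf a b).continuousOn_mul continuousOn_id
  rw [intervalIntegral.integral_interval_sub_left (hf _ _) (hf _ _),
    intervalIntegral.integral_interval_sub_left (hyf _ _) (hyf _ _),
    ← intervalIntegral.integral_const_mul,
    ← intervalIntegral.integral_sub ((hf _ _).const_mul _) (hyf _ _)]
  simp only [windowConv, sub_mul]

theorem continuous_windowConv (hf : ∀ a b, IntervalIntegrable f volume a b) :
    Continuous (windowConv R f) := by
  have hyf : ∀ a b, IntervalIntegrable (fun y => y * f y) volume a b := fun a b =>
    (hf a b).continuousOn_mul continuousOn_id
  have h1 := intervalIntegral.continuous_primitive hf 0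
  have h2 := intervalIntegral.continuous_primitive hyf 0
  rw [funext (windowConv_eq_primitive hf)]
  fun_prop

theorem absolutelyContinuousOnInterval_primitive_comp_add
    (hf : ∀ a b, IntervalIntegrable f volume a b) (c : ℝ) {a b : ℝ} :
    AbsolutelyContinuousOnInterval (fun x => ∫ y in (0 : ℝ)..(x + c), f y) a b := by
  have hshift : IntervalIntegrable (fun y => f (y + c)) volume a b := by
    simpa using (hf (a + c) (b + c)).comp_add_right c
  have h := (hshift.absolutelyContinuousOnInterval_intervalIntegral (c := a) (by simp)).add
    (contDiffOn_const (c := ∫ y in (0 : ℝ)..(a + c), f y)).absolutelyContinuousOnInterval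
  have e : (fun x => ∫ y in (0 : ℝ)..(x + c), f y)
      = (fun x => ∫ y in a..x, f (y + c)) + fun _ => ∫ y in (0 : ℝ)..(a + c), f y := by
    ext x
    rw [Pi.add_apply, intervalIntegral.integral_comp_add_right,
      add_comm (∫ y in (a + c)..(x + c), f y),
      intervalIntegral.integral_add_adjacent_intervals (hf _ _) (hf _ _)]
  rw [e]
  exact h

theorem absolutelyContinuousOnInterval_windowConv
    (hf : ∀ a b, IntervalIntegrable f volume a b) {a b : ℝ} :
    AbsolutelyContinuousOnInterval (windowConv R f) a b := by
  have hyf : ∀ a b, IntervalIntegrable (fun y => y * f y) volume a b := fun a b =>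
    (hf a b).continuousOn_mul continuousOn_id
  rw [funext (windowConv_eq_primitive hf)]
  simp only [sub_eq_add_neg _ R]
  have hid : AbsolutelyContinuousOnInterval (fun x : ℝ => x) a b :=
    contDiffOn_id.absolutelyContinuousOnInterval
  exact (hid.mul ((absolutelyContinuousOnInterval_primitive_comp_add hf R).sub
    (absolutelyContinuousOnInterval_primitive_comp_add hf (-R)))).sub
    ((absolutelyContinuousOnInterval_primitive_comp_add hyf R).sub
      (absolutelyContinuousOnInterval_primitive_comp_add hyf (-R)))

theorem windowConv_zero_of_even (heven : ∀ x, f (-x) = f x) : windowConv R f 0 = 0 := by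
  have h := intervalIntegral.integral_comp_neg (a := 0 - R) (b := 0 + R)
    (fun y => (0 - y) * f y)
  have e : (fun x => (0 - -x) * f (-x)) = fun x => -((0 - x) * f x) := by
    ext x; rw [heven]; ring
  rw [e, intervalIntegral.integral_neg] at h
  simp only [windowConv]
  ring_nf at h ⊢
  linarith

theorem windowConv_add_const_mul {g : ℝ → ℝ} (hf : ∀ a b, IntervalIntegrable f volume a b)
    (hg : ∀ a b, IntervalIntegrable g volume a b) (c x : ℝ) :
    windowConv R (fun y => f y + c * g y) x = windowConv R f x + c * windowConv R g x := by
  have hm : ∀ {h : ℝ → ℝ}, (∀ a b, IntervalIntegrable h volume a b) →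
      ∀ a b, IntervalIntegrable (fun y => (x - y) * h y) volume a b := fun hh a b =>
    (hh a b).continuousOn_mul (by fun_prop)
  simp only [windowConv]
  rw [← intervalIntegral.integral_const_mul,
    ← intervalIntegral.integral_add (hm hf _ _) ((hm hg _ _).const_mul _)]
  congr 1
  ext y
  ring

theorem windowConv_const (c x : ℝ) : windowConv R (fun _ => c) x = 0 := by
  simp only [windowConv, intervalIntegral.integral_mul_const]
  rw [intervalIntegral.integral_sub (by simp) (by simp)]
  simp only [intervalIntegral.integral_const, integral_id, smul_eq_mul]
  ring

theorem abs_windowConv_le (hR : 0 ≤ R) (hR1 : R ≤ 1) (hf0 : ∀ x, 0 ≤ f x)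
    (hper : Function.Periodic f 2) (hf : ∀ a b, IntervalIntegrable f volume a b) (x : ℝ) :
    |windowConv R f x| ≤ R * ∫ y in (-1 : ℝ)..1, f y := by
  have hle : x - R ≤ x + R := by linarith
  calc |windowConv R f x| ≤ ∫ y in (x - R)..(x + R), |(x - y) * f y| :=
        intervalIntegral.abs_integral_le_integral_abs hle
    _ ≤ ∫ y in (x - R)..(x + R), R * f y := by
        refine intervalIntegral.integral_mono_on hle
          ((hf _ _).continuousOn_mul (by fun_prop)).abs ((hf _ _).const_mul _) fun y hy => ?_
        rw [abs_mul, abs_of_nonneg (hf0 y)]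
        refine mul_le_mul_of_nonneg_right ?_ (hf0 y)
        rw [abs_le]
        constructor <;> linarith [hy.1, hy.2]
    _ = R * ∫ y in (x - R)..(x + R), f y := intervalIntegral.integral_const_mul _ _
    _ ≤ R * ∫ y in (x - 1)..(x - 1 + 2), f y := by
        refine mul_le_mul_of_nonneg_left ?_ hR
        exact intervalIntegral.integral_mono_interval (by linarith) hle (by linarith)
          (Filter.Eventually.of_forall hf0) (hf _ _)
    _ = R * ∫ y in (-1 : ℝ)..1, f y := by
        rw [hper.intervalIntegral_add_eq (x - 1) (-1)]
        norm_num

theorem integral_integral_window {g : ℝ → ℝ} (hper : Function.Periodic g 2)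
    (hg : ∀ a b, IntervalIntegrable g volume a b) :
    ∫ x in (-1 : ℝ)..1, ∫ y in (x - R)..(x + R), g y = 2 * R * ∫ y in (-1 : ℝ)..1, g y := by
  set F : ℝ → ℝ := fun x => ∫ y in (0 : ℝ)..x, g y with hF
  have hFc : Continuous F := intervalIntegral.continuous_primitive hg 0
  have hi : ∀ a b, IntervalIntegrable F volume a b := fun a b => hFc.intervalIntegrable a b
  have hFper : ∀ x, F (x + 2) - F x = ∫ y in (-1 : ℝ)..1, g y := by
    intro x
    simp only [hF]
    rw [intervalIntegral.integral_interval_sub_left (hg _ _) (hg _ _),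
      hper.intervalIntegral_add_eq x (-1)]
    norm_num
  have e : ∀ x, ∫ y in (x - R)..(x + R), g y = F (x + R) - F (x - R) := fun x =>
    (intervalIntegral.integral_interval_sub_left (hg _ _) (hg _ _)).symm
  simp only [e]
  have hadd : ∀ c a b, IntervalIntegrable (fun x => F (x + c)) volume a b := fun c a b =>
    Continuous.intervalIntegrable (by fun_prop) _ _
  have hsub : ∀ c a b, IntervalIntegrable (fun x => F (x - c)) volume a b := fun c a b =>
    Continuous.intervalIntegrable (by fun_prop) _ _
  rw [intervalIntegral.integral_sub (hadd _ _ _) (hsub _ _ _),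
    intervalIntegral.integral_comp_add_right, intervalIntegral.integral_comp_sub_right,
    intervalIntegral.integral_interval_sub_interval_comm' (hi _ _) (hi _ _) (hi _ _)]
  have h2 : ∫ x in (1 - R)..(1 + R), F x = ∫ x in (-1 - R)..(-1 + R), F (x + 2) := by
    rw [intervalIntegral.integral_comp_add_right]
    congr 1 <;> ring
  rw [h2, ← intervalIntegral.integral_sub (hadd _ _ _) (hi _ _)]
  simp only [hFper, intervalIntegral.integral_const, smul_eq_mul]
  ring

theorem sq_windowConv_le (hR : 0 ≤ R) (hf : ∀ a b, IntervalIntegrable f volume a b)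
    (hf2 : ∀ a b, IntervalIntegrable (fun x => f x ^ 2) volume a b) (x : ℝ) :
    windowConv R f x ^ 2 ≤ 2 * R ^ 3 / 3 * ∫ y in (x - R)..(x + R), f y ^ 2 := by
  have h := sq_intervalIntegral_mul_le (f := fun y => x - y) (g := f)
    (by linarith : x - R ≤ x + R)
    (Continuous.intervalIntegrable (by fun_prop) _ _) (hf2 _ _)
    ((hf _ _).continuousOn_mul (by fun_prop))
  have e : ∫ y in (x - R)..(x + R), (x - y) ^ 2 = 2 * R ^ 3 / 3 := by
    rw [intervalIntegral.integral_comp_sub_left (fun t => t ^ 2), integral_pow]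
    push_cast
    ring
  rwa [e] at h

theorem sqrt_integral_sq_windowConv_le (hR : 0 ≤ R) (hper : Function.Periodic f 2)
    (hf : ∀ a b, IntervalIntegrable f volume a b)
    (hf2 : ∀ a b, IntervalIntegrable (fun x => f x ^ 2) volume a b) :
    √(∫ x in (-1 : ℝ)..1, windowConv R f x ^ 2)
      ≤ 2 * R ^ 2 / √3 * √(∫ x in (-1 : ℝ)..1, f x ^ 2) := by
  have hper2 : Function.Periodic (fun x => f x ^ 2) 2 := fun x => by simp only [hper x]
  have hc : Continuous fun x => ∫ y in (x - R)..(x + R), f y ^ 2 := by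
    have h1 := intervalIntegral.continuous_primitive hf2 0
    have e : (fun x => ∫ y in (x - R)..(x + R), f y ^ 2)
        = fun x => (∫ y in (0 : ℝ)..(x + R), f y ^ 2) - ∫ y in (0 : ℝ)..(x - R), f y ^ 2 :=
      funext fun x => (intervalIntegral.integral_interval_sub_left (hf2 _ _) (hf2 _ _)).symm
    rw [e]
    fun_prop
  have h : ∫ x in (-1 : ℝ)..1, windowConv R f x ^ 2
      ≤ (2 * R ^ 2 / √3) ^ 2 * ∫ x in (-1 : ℝ)..1, f x ^ 2 := by
    calc ∫ x in (-1 : ℝ)..1, windowConv R f x ^ 2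
        ≤ ∫ x in (-1 : ℝ)..1, 2 * R ^ 3 / 3 * ∫ y in (x - R)..(x + R), f y ^ 2 :=
          intervalIntegral.integral_mono_on (by norm_num)
            (((continuous_windowConv hf).pow 2).intervalIntegrable _ _)
            ((hc.const_mul _).intervalIntegrable _ _) fun x _ => sq_windowConv_le hR hf hf2 x
      _ = (2 * R ^ 2 / √3) ^ 2 * ∫ x in (-1 : ℝ)..1, f x ^ 2 := by
          rw [intervalIntegral.integral_const_mul, integral_integral_window hper2 hf2, div_pow,
            Real.sq_sqrt (by norm_num)]
          ring
  refine (Real.sqrt_le_sqrt h).trans_eq ?_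
  rw [Real.sqrt_mul (sq_nonneg _), Real.sqrt_sq (by positivity)]

end windowConv

theorem IsEvenPeriodicDensity.integral_neg_one_one {f : ℝ → ℝ} (hf : IsEvenPeriodicDensity f)
    (hi : IntervalIntegrable f volume (-1) 1) : ∫ x in (-1 : ℝ)..1, f x = 2 := by
  rw [integral_neg_one_one_of_even hf.2.1 hi, hf.2.2.2, mul_one]

theorem IsEvenPeriodicDensity.intervalIntegrable {f : ℝ → ℝ} (hf : IsEvenPeriodicDensity f)
    (a b : ℝ) : IntervalIntegrable f volume a b := by
  have h01 : IntervalIntegrable f volume 0 1 := by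
    by_contra h
    have := intervalIntegral.integral_undef h
    rw [hf.2.2.2] at this
    exact one_ne_zero this
  have h10 : IntervalIntegrable f volume (-1) 0 := by
    have h := (IntervalIntegrable.iff_comp_neg).1 h01
    simp only [hf.2.1, neg_zero] at h
    exact h.symm
  have hper : Function.Periodic f 2 := hf.1
  refine hper.intervalIntegrable two_ne_zero (t := -1) ?_ a b
  convert h10.trans h01 using 1
  norm_num

/-- Integrated form of the stationary equation: the probability flux vanishes. -/
theorem half_sq_mul_deriv_add_mul_eq_zero {σ : ℝ} {ρ g : ℝ → ℝ} (hρ : ContDiff ℝ 2 ρ)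
    (heven : ∀ x, ρ (-x) = ρ x) (hg : AbsolutelyContinuousOnInterval g (-1) 1) (hg0 : g 0 = 0)
    (hstat : ∀ x, σ ^ 2 / 2 * deriv (deriv ρ) x + deriv (fun y => ρ y * g y) x = 0)
    {x : ℝ} (hx : x ∈ Set.uIcc (-1 : ℝ) 1) : σ ^ 2 / 2 * deriv ρ x + ρ x * g x = 0 := by
  have hρ' : ContDiff ℝ 1 (deriv ρ) := hρ.deriv'
  have hac : AbsolutelyContinuousOnInterval (fun x => ρ x * g x) (-1) 1 :=
    (hρ.of_le one_le_two).contDiffOn.absolutelyContinuousOnInterval.mul hg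
  have hflux : AbsolutelyContinuousOnInterval
      (fun x => σ ^ 2 / 2 * deriv ρ x + ρ x * g x) (-1) 1 :=
    (hρ'.contDiffOn.absolutelyContinuousOnInterval.const_mul _).add hac
  obtain ⟨C, hC⟩ := hflux.const_of_ae_hasDerivAt_zero (by
    filter_upwards [hac.ae_differentiableAt] with y hy hmem
    have h1 := ((hρ'.differentiable one_ne_zero y).hasDerivAt.const_mul (σ ^ 2 / 2)).add
      (hy hmem).hasDerivAt
    rw [hstat y] at h1
    exact h1)
  have hd0 : deriv ρ 0 = 0 := by
    have h := deriv_comp_neg ρ 0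
    simp only [heven, neg_zero] at h
    linarith
  rw [hC x hx, ← hC 0 (by rw [Set.uIcc_of_le (by norm_num)]; norm_num), hd0, hg0]
  ring

/-- Wirtinger's inequality for even functions of mean zero on `[-1, 1]`. -/
theorem pi_mul_sqrt_integral_sq_le {f f' : ℝ → ℝ} (hf : ∀ x, HasDerivAt f (f' x) x)
    (hf' : Continuous f') (heven : ∀ x, f (-x) = f x) (hmean : ∫ x in (0 : ℝ)..1, f x = 0) :
    π * √(∫ x in (-1 : ℝ)..1, f x ^ 2) ≤ √(∫ x in (-1 : ℝ)..1, f' x ^ 2) := by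
  have hfc : Continuous f := continuous_iff_continuousAt.2 fun x => (hf x).continuousAt
  have hodd : ∀ x, f' (-x) = -f' x := by
    intro x
    have h1 := (hf (-x)).comp x (hasDerivAt_neg x)
    have e : f ∘ Neg.neg = f := funext heven
    rw [e] at h1
    have := h1.unique (hf x)
    linarith
  have hi : ∀ {g : ℝ → ℝ}, Continuous g → IntervalIntegrable (fun x => g x ^ 2) volume (-1) 1 :=
    fun hg => (hg.pow 2).intervalIntegrable _ _
  rw [integral_neg_one_one_of_even (fun x => by rw [heven]) (hi hfc),
    integral_neg_one_one_of_even (fun x => by rw [hodd, neg_sq]) (hi hf')]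
  have h := pi_sq_mul_integral_sq_le_of_integral_eq_zero hf hf' hmean
  refine Real.le_sqrt_of_sq_le ?_
  rw [mul_pow, Real.sq_sqrt (mul_nonneg zero_le_two
    (intervalIntegral.integral_nonneg zero_le_one fun x _ => sq_nonneg _))]
  linarith

theorem sqrt_integral_sq_mul_le {f g : ℝ → ℝ} {K : ℝ} (hf : Continuous f) (hg : Continuous g)
    (hK : ∀ x, |g x| ≤ K) :
    √(∫ x in (-1 : ℝ)..1, (f x * g x) ^ 2) ≤ K * √(∫ x in (-1 : ℝ)..1, f x ^ 2) := by
  have hK0 : 0 ≤ K := (abs_nonneg _).trans (hK 0)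
  have h : ∫ x in (-1 : ℝ)..1, (f x * g x) ^ 2 ≤ K ^ 2 * ∫ x in (-1 : ℝ)..1, f x ^ 2 := by
    rw [← intervalIntegral.integral_const_mul]
    refine intervalIntegral.integral_mono_on (by norm_num)
      (((hf.mul hg).pow 2).intervalIntegrable _ _)
      (((hf.pow 2).const_mul _).intervalIntegrable _ _) fun x _ => ?_
    have := pow_le_pow_left₀ (abs_nonneg _) (hK x) 2
    rw [sq_abs] at this
    rw [mul_pow, mul_comm]
    gcongr
  refine (Real.sqrt_le_sqrt h).trans_eq ?_
  rw [Real.sqrt_mul (sq_nonneg _), Real.sqrt_sq hK0]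

theorem stmt_0 (R M σ η : ℝ) (hR : 0 < R) (hR1 : R ≤ 1) (hM : 0 ≤ M)
    (hσ : 0 < σ) (hη : 0 < η)
    (ρr : ℝ → ℝ) (hρr : IsEvenPeriodicDensity ρr)
    (hρrL2 : IntervalIntegrable (fun x => (ρr x) ^ 2) volume (-1) 1)
    (ρs : ℝ → ℝ) (hρs : ContDiff ℝ 2 ρs) (hρsd : IsEvenPeriodicDensity ρs)
    (hstat : ∀ x : ℝ,
      σ ^ 2 / 2 * deriv (deriv ρs) x + deriv (fun y => ρs y * G R M ρs ρr y) x = 0)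
    (hbig : σ ^ 2 > (4 * R / π) * (M + R / Real.sqrt 3 + 2)
              + η * (4 * R ^ 2 * M / (π * Real.sqrt 3))) :
    Real.sqrt (∫ x in (-1:ℝ)..1, (ρs x - 1) ^ 2)
      ≤ (1 / η) * Real.sqrt (∫ x in (-1:ℝ)..1, (ρr x) ^ 2) := by
  have hri := hρr.intervalIntegrable
  have hsi := hρsd.intervalIntegrable
  have hr2 : ∀ a b, IntervalIntegrable (fun x => ρr x ^ 2) volume a b := by
    have hper : Function.Periodic (fun x => ρr x ^ 2) 2 := fun x => by simp only [hρr.1 x]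
    refine hper.intervalIntegrable two_ne_zero (t := -1) ?_
    norm_num
    exact hρrL2
  set ψ : ℝ → ℝ := fun x => ρs x - 1 with hψ
  set μ : ℝ → ℝ := fun y => ρs y + M * ρr y with hμ
  have hψd : ∀ x, HasDerivAt ψ (deriv ρs x) x := fun x =>
    ((hρs.differentiable two_ne_zero x).hasDerivAt.sub_const 1)
  have hψc : Continuous ψ := hρs.continuous.sub continuous_const
  have hdc : Continuous (deriv ρs) := hρs.continuous_deriv one_le_two
  have hψi : ∀ a b, IntervalIntegrable ψ volume a b := fun a b => hψc.intervalIntegrable a b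
  have hμi : ∀ a b, IntervalIntegrable μ volume a b := fun a b =>
    (hsi a b).add ((hri a b).const_mul M)
  have hG : G R M ρs ρr = windowConv R μ := rfl
  have hGc : Continuous (windowConv R μ) := continuous_windowConv hμi
  have hμeven : ∀ x, μ (-x) = μ x := fun x => by simp only [hμ, hρsd.2.1, hρr.2.1]
  have hμper : Function.Periodic μ 2 := fun x => by simp only [hμ, hρsd.1 x, hρr.1 x]
  have hμ0 : ∀ x, 0 ≤ μ x := fun x =>
    add_nonneg (hρsd.2.2.1 x) (mul_nonneg hM (hρr.2.2.1 x))
  have hμint : ∫ y in (-1 : ℝ)..1, μ y = 2 * (1 + M) := by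
    simp only [hμ]
    rw [intervalIntegral.integral_add (hsi _ _) ((hri _ _).const_mul _),
      intervalIntegral.integral_const_mul, hρsd.integral_neg_one_one (hsi _ _),
      hρr.integral_neg_one_one (hri _ _)]
    ring
  have hGbd : ∀ x, |windowConv R μ x| ≤ R * (2 * (1 + M)) := fun x => by
    rw [← hμint]
    exact abs_windowConv_le hR.le hR1 hμ0 hμper hμi x
  have hGsplit : ∀ x, windowConv R μ x = windowConv R ψ x + M * windowConv R ρr x := by
    intro x
    have h1 := windowConv_add_const_mul (R := R) hsi hri M x
    have h2 := windowConv_add_const_mul (R := R) hψi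
      (g := fun _ => 1) (fun a b => by simp) 1 x
    rw [windowConv_const, mul_zero, add_zero] at h2
    have e : (fun y => ψ y + 1 * (1 : ℝ)) = ρs := by ext y; simp [hψ]
    rw [e] at h2
    rw [← h2]
    exact h1
  rw [hG] at hstat
  have hflux : ∀ x ∈ Set.uIcc (-1 : ℝ) 1,
      σ ^ 2 / 2 * deriv ρs x + ρs x * windowConv R μ x = 0 := fun x hx =>
    half_sq_mul_deriv_add_mul_eq_zero hρs hρsd.2.1
      (absolutelyContinuousOnInterval_windowConv hμi) (windowConv_zero_of_even hμeven) hstat hx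
  have hwψ : Continuous (windowConv R ψ) := continuous_windowConv hψi
  have hwr : Continuous (windowConv R ρr) := continuous_windowConv hri
  set P := √(∫ x in (-1 : ℝ)..1, ψ x ^ 2) with hP
  set Q := √(∫ x in (-1 : ℝ)..1, ρr x ^ 2) with hQ
  set D := √(∫ x in (-1 : ℝ)..1, deriv ρs x ^ 2) with hD
  have hP0 : 0 ≤ P := Real.sqrt_nonneg _
  have hQ0 : 0 ≤ Q := Real.sqrt_nonneg _
  have hD0 : 0 ≤ D := Real.sqrt_nonneg _
  have hwirt : π * P ≤ D := by
    refine pi_mul_sqrt_integral_sq_le hψd hdc (fun x => by simp only [hψ, hρsd.2.1]) ?_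
    simp only [hψ]
    rw [intervalIntegral.integral_sub (hsi _ _) (by simp), hρsd.2.2.2]
    simp
  have henergy : σ ^ 2 / 2 * D ^ 2
      ≤ D * (R * (2 * (1 + M)) * P + 2 * R ^ 2 / √3 * P + M * (2 * R ^ 2 / √3 * Q)) := by
    have hDsq : D ^ 2 = ∫ x in (-1 : ℝ)..1, deriv ρs x ^ 2 :=
      Real.sq_sqrt (intervalIntegral.integral_nonneg (by norm_num) fun x _ => sq_nonneg _)
    have h1 : |∫ x in (-1 : ℝ)..1, deriv ρs x * (ψ x * windowConv R μ x)|
        ≤ D * (R * (2 * (1 + M)) * P) :=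
      (abs_intervalIntegral_mul_le (by norm_num) hdc (hψc.mul hGc)).trans
        (mul_le_mul_of_nonneg_left (sqrt_integral_sq_mul_le hψc hGc hGbd) hD0)
    have h2 : |∫ x in (-1 : ℝ)..1, deriv ρs x * windowConv R ψ x|
        ≤ D * (2 * R ^ 2 / √3 * P) :=
      (abs_intervalIntegral_mul_le (by norm_num) hdc hwψ).trans
        (mul_le_mul_of_nonneg_left (sqrt_integral_sq_windowConv_le hR.le
          (fun x => by simp only [hψ, hρsd.1 x]) hψi
          fun a b => (hψc.pow 2).intervalIntegrable a b) hD0)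
    have h3 : |∫ x in (-1 : ℝ)..1, deriv ρs x * windowConv R ρr x|
        ≤ D * (2 * R ^ 2 / √3 * Q) :=
      (abs_intervalIntegral_mul_le (by norm_num) hdc hwr).trans
        (mul_le_mul_of_nonneg_left (sqrt_integral_sq_windowConv_le hR.le hρr.1 hri hr2) hD0)
    have hsum : σ ^ 2 / 2 * D ^ 2 = -((∫ x in (-1 : ℝ)..1, deriv ρs x * (ψ x * windowConv R μ x))
        + (∫ x in (-1 : ℝ)..1, deriv ρs x * windowConv R ψ x)
        + M * ∫ x in (-1 : ℝ)..1, deriv ρs x * windowConv R ρr x) := by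
      have hi1 : IntervalIntegrable (fun x => deriv ρs x * (ψ x * windowConv R μ x)) volume (-1) 1 :=
        (hdc.mul (hψc.mul hGc)).intervalIntegrable _ _
      have hi2 : IntervalIntegrable (fun x => deriv ρs x * windowConv R ψ x) volume (-1) 1 :=
        (hdc.mul hwψ).intervalIntegrable _ _
      have hi3 : IntervalIntegrable (fun x => deriv ρs x * windowConv R ρr x) volume (-1) 1 :=
        (hdc.mul hwr).intervalIntegrable _ _
      rw [hDsq, ← intervalIntegral.integral_const_mul, ← intervalIntegral.integral_const_mul,
        ← intervalIntegral.integral_add hi1 hi2,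
        ← intervalIntegral.integral_add (hi1.add hi2) (hi3.const_mul _),
        ← intervalIntegral.integral_neg]
      refine intervalIntegral.integral_congr fun x hx => ?_
      have hs := hGsplit x
      simp only [hψ] at hs ⊢
      linear_combination deriv ρs x * hflux x hx - deriv ρs x * hs
    have h4 := mul_le_mul_of_nonneg_left ((neg_le_abs _).trans h3) hM
    linarith [(neg_le_abs _).trans h1, (neg_le_abs _).trans h2]
  have hfinal : σ ^ 2 / 2 * (π * P)
      ≤ R * (2 * (1 + M)) * P + 2 * R ^ 2 / √3 * P + M * (2 * R ^ 2 / √3 * Q) := by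
    refine (mul_le_mul_of_nonneg_left hwirt (by positivity)).trans ?_
    rcases hD0.eq_or_lt with h | h
    · rw [← h, mul_zero]; positivity
    · exact le_of_mul_le_mul_left (by linarith) h
  by_contra! hlt
  have hPpos : 0 < P := lt_of_le_of_lt (by positivity) hlt
  have hQP : Q < η * P := by
    rw [one_div, inv_mul_lt_iff₀ hη] at hlt
    exact hlt
  have hscaled : (4 * R / π * (M + R / √3 + 2) + η * (4 * R ^ 2 * M / (π * √3))) * (π * P / 2)
      = R * (2 * (M + 2)) * P + 2 * R ^ 2 / √3 * P + M * (2 * R ^ 2 / √3 * (η * P)) := by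
    field_simp
    ring
  have hstrict := mul_lt_mul_of_pos_right hbig (by positivity : 0 < π * P / 2)
  have hMQ : M * (2 * R ^ 2 / √3 * Q) ≤ M * (2 * R ^ 2 / √3 * (η * P)) := by gcongr
  nlinarith [mul_pos hR hPpos]
end

section
/- Let 0 < R ≤ 1, M ≥ 0 and σ > 0. Let ρ_r be a continuously differentiable even 2-periodic probability density. Then there exists a twice continuously differentiable, strictly positive, even 2-periodic probability density ρˢ satisfying the stationary Fokker–Planck equation (σ²/2) (ρˢ)''(x) + d/dx (ρˢ(x) G_{ρˢ}(x)) = 0 for all x ∈ ℝ. -/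
open MeasureTheory Real

section GibbsDensity

variable {X : Type*} [MetricSpace X] [MeasurableSpace X] (μ : Measure X)

/-- The normalised Gibbs density `exp(-V) / ∫ exp(-V)` of a potential `V`. -/
noncomputable def gibbsDensity (V : C(X, ℝ)) : C(X, ℝ) where
  toFun x := exp (-V x) / ∫ y, exp (-V y) ∂μ
  continuous_toFun := by fun_prop

lemma gibbsDensity_apply (V : C(X, ℝ)) (x : X) :
    gibbsDensity μ V x = exp (-V x) / ∫ y, exp (-V y) ∂μ := rfl

end GibbsDensity

section Gibbs

variable {X : Type*} [MetricSpace X] [CompactSpace X] [MeasurableSpace X] [BorelSpace X]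
  (μ : Measure X) [IsProbabilityMeasure μ]

lemma ContinuousMap.integrable_of_compactSpace (f : C(X, ℝ)) : Integrable f μ :=
  f.continuous.integrable_of_hasCompactSupport (HasCompactSupport.of_compactSpace f)

lemma ContinuousMap.continuous_integral_probability :
    Continuous fun f : C(X, ℝ) => ∫ x, f x ∂μ := by
  refine LipschitzWith.continuous (K := 1) (LipschitzWith.of_dist_le_mul fun f g => ?_)
  rw [Real.dist_eq, ← integral_sub (f.integrable_of_compactSpace μ)
    (g.integrable_of_compactSpace μ), ← Real.norm_eq_abs]
  refine (norm_integral_le_of_norm_le_const (C := dist f g) (ae_of_all _ fun x => ?_)).trans ?_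
  · simpa [Real.dist_eq] using ContinuousMap.dist_apply_le_dist (f := f) (g := g) x
  · simp

/-- The potential `x ↦ ∫ K(x, y) ρ(y) dμ(y)` generated by `ρ` through the kernel `K`. -/
noncomputable def kernelPotential (K : C(X × X, ℝ)) (ρ : C(X, ℝ)) : C(X, ℝ) where
  toFun x := ∫ y, (K.curry x * ρ) y ∂μ
  continuous_toFun := (ContinuousMap.continuous_integral_probability μ).comp (by fun_prop)

lemma kernelPotential_apply (K : C(X × X, ℝ)) (ρ : C(X, ℝ)) (x : X) :
    kernelPotential μ K ρ x = ∫ y, K (x, y) * ρ y ∂μ := rfl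

lemma continuous_kernelPotential (K : C(X × X, ℝ)) : Continuous (kernelPotential μ K) := by
  refine ContinuousMap.continuous_of_continuous_uncurry _ ?_
  exact (ContinuousMap.continuous_integral_probability μ).comp
    (g := fun f : C(X, ℝ) => ∫ x, f x ∂μ)
    (f := fun p : C(X, ℝ) × X => K.curry p.2 * p.1) (by fun_prop)

lemma kernelPotential_add_smul (K : C(X × X, ℝ)) (ρ d : C(X, ℝ)) (t : ℝ) :
    kernelPotential μ K (ρ + t • d) = kernelPotential μ K ρ + t • kernelPotential μ K d := by
  ext x
  have h1 := (K.curry x * ρ).integrable_of_compactSpace μ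
  have h2 := (t • (K.curry x * d)).integrable_of_compactSpace μ
  have h := integral_add h1 h2
  simp only [ContinuousMap.mul_apply, ContinuousMap.smul_apply, ContinuousMap.curry_apply,
    smul_eq_mul, integral_const_mul] at h
  simp only [kernelPotential_apply, ContinuousMap.add_apply, ContinuousMap.smul_apply,
    smul_eq_mul, ← h]
  exact integral_congr_ae (ae_of_all _ fun y => by ring)

lemma integral_mul_kernelPotential_comm (K : C(X × X, ℝ)) (hK : ∀ x y, K (x, y) = K (y, x))
    (ρ d : C(X, ℝ)) :
    ∫ x, d x * kernelPotential μ K ρ x ∂μ = ∫ x, ρ x * kernelPotential μ K d x ∂μ := by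
  have hI : Integrable (fun p : X × X => d p.1 * (K p * ρ p.2)) (μ.prod μ) :=
    Continuous.integrable_of_hasCompactSupport (by fun_prop) (HasCompactSupport.of_compactSpace _)
  simp only [kernelPotential_apply, ← integral_const_mul]
  rw [integral_integral_swap hI]
  refine integral_congr_ae (ae_of_all _ fun y => integral_congr_ae (ae_of_all _ fun x => ?_))
  simp only [hK x y]
  ring

/-- Densities bounded between `m` and `B` whose oscillation is controlled by that of `K`. -/
def controlledDensities (K : C(X × X, ℝ)) (m B A : ℝ) : Set C(X, ℝ) :=
  {f | (∀ x, f x ∈ Set.Icc m B) ∧ ∀ x y, |f x - f y| ≤ A * ‖K.curry x - K.curry y‖} ∩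
    {f | ∫ x, f x ∂μ = 1}

lemma isCompact_controlledDensities (K : C(X × X, ℝ)) (m B A : ℝ) :
    IsCompact (controlledDensities μ K m B A) := by
  refine IsCompact.inter_right ?_
    (isClosed_singleton.preimage (ContinuousMap.continuous_integral_probability μ))
  refine ArzelaAscoli.isCompact_of_equicontinuous _ ?_ ?_
  · have hc : IsCompact (Set.pi Set.univ (fun _ : X => Set.Icc m B) ∩
        {f : X → ℝ | ∀ x y, |f x - f y| ≤ A * ‖K.curry x - K.curry y‖}) := by
      refine (isCompact_univ_pi fun _ => isCompact_Icc).inter_right ?_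
      simp only [Set.ofPred_forall]
      exact isClosed_iInter fun x => isClosed_iInter fun y =>
        isClosed_le (by fun_prop) continuous_const
    convert hc using 1
    ext f
    constructor
    · rintro ⟨g, hg, rfl⟩
      exact ⟨fun x _ => hg.1 x, hg.2⟩
    · rintro ⟨h1, h2⟩
      have hf : Continuous f := by
        refine continuous_iff_continuousAt.2 fun x => ?_
        rw [ContinuousAt, tendsto_iff_norm_sub_tendsto_zero]
        have hlim : Filter.Tendsto (fun y => A * ‖K.curry y - K.curry x‖) (nhds x) (nhds 0) := by
          have : Continuous fun y => A * ‖K.curry y - K.curry x‖ := by fun_prop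
          simpa using this.tendsto x
        exact squeeze_zero (fun _ => norm_nonneg _) (fun y => h2 y x) hlim
      exact ⟨⟨f, hf⟩, ⟨fun x => h1 x trivial, h2⟩, rfl⟩
  · intro x
    have hlim : Filter.Tendsto (fun y => A * ‖K.curry x - K.curry y‖) (nhds x) (nhds 0) := by
      have : Continuous fun y => A * ‖K.curry x - K.curry y‖ := by fun_prop
      simpa using this.tendsto x
    exact Metric.equicontinuousAt_of_continuity_modulus _ hlim _
      (Filter.Eventually.of_forall fun y f => f.2.2 x y)

lemma convex_controlledDensities (K : C(X × X, ℝ)) (m B A : ℝ) :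
    Convex ℝ (controlledDensities μ K m B A) := by
  rintro f ⟨⟨hf1, hf2⟩, hf3⟩ g ⟨⟨hg1, hg2⟩, hg3⟩ a b ha hb hab
  refine ⟨⟨fun x => (convex_Icc m B) (hf1 x) (hg1 x) ha hb hab, fun x y => ?_⟩, ?_⟩
  · have e : (a • f + b • g) x - (a • f + b • g) y = a * (f x - f y) + b * (g x - g y) := by
      simp; ring
    rw [e]
    calc _ ≤ |a * (f x - f y)| + |b * (g x - g y)| := abs_add_le _ _
      _ = a * |f x - f y| + b * |g x - g y| := by
        rw [abs_mul, abs_mul, abs_of_nonneg ha, abs_of_nonneg hb]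
      _ ≤ a * (A * ‖K.curry x - K.curry y‖) + b * (A * ‖K.curry x - K.curry y‖) := by
        gcongr
        exacts [hf2 x y, hg2 x y]
      _ = _ := by rw [← add_mul, hab, one_mul]
  · have h := integral_add ((a • f).integrable_of_compactSpace μ)
      ((b • g).integrable_of_compactSpace μ)
    simp only [ContinuousMap.smul_apply, smul_eq_mul, integral_const_mul] at h
    simp only [Set.mem_ofPred_eq] at hf3 hg3 ⊢
    simp only [ContinuousMap.add_apply, ContinuousMap.smul_apply, smul_eq_mul, h, hf3, hg3]
    linarith

lemma abs_kernelPotential_le {K : C(X × X, ℝ)} {ρ : C(X, ℝ)} (h0 : ∀ x, 0 ≤ ρ x)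
    (h1 : ∫ x, ρ x ∂μ = 1) (x : X) : |kernelPotential μ K ρ x| ≤ ‖K‖ := by
  rw [kernelPotential_apply, ← Real.norm_eq_abs]
  refine (norm_integral_le_of_norm_le ((‖K‖ • ρ).integrable_of_compactSpace μ)
    (ae_of_all _ fun y => ?_)).trans_eq ?_
  · rw [norm_mul, Real.norm_of_nonneg (h0 y)]
    exact mul_le_mul_of_nonneg_right (K.norm_coe_le_norm _) (h0 y)
  · simp [integral_const_mul, h1]

lemma abs_kernelPotential_sub_le {K : C(X × X, ℝ)} {ρ : C(X, ℝ)} (h0 : ∀ x, 0 ≤ ρ x)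
    (h1 : ∫ x, ρ x ∂μ = 1) (x y : X) :
    |kernelPotential μ K ρ x - kernelPotential μ K ρ y| ≤ ‖K.curry x - K.curry y‖ := by
  have e := integral_sub ((K.curry x * ρ).integrable_of_compactSpace μ)
    ((K.curry y * ρ).integrable_of_compactSpace μ)
  change |(∫ z, (K.curry x * ρ) z ∂μ) - ∫ z, (K.curry y * ρ) z ∂μ| ≤ _
  rw [← e, ← Real.norm_eq_abs]
  refine (norm_integral_le_of_norm_le
    ((‖K.curry x - K.curry y‖ • ρ).integrable_of_compactSpace μ)
    (ae_of_all _ fun z => ?_)).trans_eq ?_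
  · have : (K.curry x * ρ) z - (K.curry y * ρ) z = (K.curry x - K.curry y) z * ρ z := by
      simp only [ContinuousMap.mul_apply, ContinuousMap.sub_apply]; ring
    rw [this, norm_mul, Real.norm_of_nonneg (h0 z)]
    exact mul_le_mul_of_nonneg_right ((K.curry x - K.curry y).norm_coe_le_norm _) (h0 z)
  · simp [integral_const_mul, h1]

lemma integral_exp_neg_mem_Icc {V : C(X, ℝ)} {c : ℝ} (hV : ∀ x, |V x| ≤ c) :
    ∫ y, exp (-V y) ∂μ ∈ Set.Icc (exp (-c)) (exp c) := by
  have hi : Integrable (fun y => exp (-V y)) μ :=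
    Continuous.integrable_of_hasCompactSupport (by fun_prop) (HasCompactSupport.of_compactSpace _)
  constructor
  · have := integral_mono (μ := μ) (integrable_const (exp (-c))) hi
      fun y => exp_le_exp.2 (neg_le_neg ((le_abs_self _).trans (hV y)))
    simpa using this
  · have := integral_mono (μ := μ) hi (integrable_const (exp c))
      fun y => exp_le_exp.2 ((neg_le_abs _).trans (hV y))
    simpa using this

lemma abs_exp_sub_exp_le {a b c : ℝ} (ha : a ≤ c) (hb : b ≤ c) :
    |exp a - exp b| ≤ exp c * |a - b| := by
  wlog h : b ≤ a generalizing a b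
  · rw [abs_sub_comm, abs_sub_comm a]
    exact this hb ha (le_of_not_ge h)
  rw [abs_of_nonneg (sub_nonneg.2 (exp_le_exp.2 h)), abs_of_nonneg (sub_nonneg.2 h)]
  have h1 : exp b = exp a * exp (b - a) := by rw [← exp_add]; ring_nf
  have h2 := add_one_le_exp (b - a)
  have h3 := exp_le_exp.2 ha
  have h4 := exp_pos a
  nlinarith

lemma gibbsDensity_mem_controlledDensities {K : C(X × X, ℝ)} {ρ : C(X, ℝ)} (h0 : ∀ x, 0 ≤ ρ x)
    (h1 : ∫ x, ρ x ∂μ = 1) :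
    gibbsDensity μ (kernelPotential μ K ρ) ∈
      controlledDensities μ K (exp (-(2 * ‖K‖))) (exp (2 * ‖K‖)) (exp (2 * ‖K‖)) := by
  have hV := abs_kernelPotential_le (K := K) μ h0 h1
  have hd := abs_kernelPotential_sub_le (K := K) μ h0 h1
  set V := kernelPotential μ K ρ
  obtain ⟨hZ1, hZ2⟩ := integral_exp_neg_mem_Icc μ hV
  have hZ : 0 < ∫ y, exp (-V y) ∂μ := (exp_pos _).trans_le hZ1
  have e2 : exp (2 * ‖K‖) * exp (-‖K‖) = exp ‖K‖ := by rw [← exp_add]; ring_nf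
  have e3 : exp (-(2 * ‖K‖)) * exp ‖K‖ = exp (-‖K‖) := by rw [← exp_add]; ring_nf
  refine ⟨⟨fun x => ⟨?_, ?_⟩, fun x y => ?_⟩, ?_⟩
  · rw [gibbsDensity_apply, le_div_iff₀ hZ]
    calc _ ≤ exp (-(2 * ‖K‖)) * exp ‖K‖ := by gcongr
      _ = exp (-‖K‖) := e3
      _ ≤ _ := exp_le_exp.2 (neg_le_neg ((le_abs_self _).trans (hV x)))
  · rw [gibbsDensity_apply, div_le_iff₀ hZ]
    calc _ ≤ exp ‖K‖ := exp_le_exp.2 ((neg_le_abs _).trans (hV x))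
      _ = _ := e2.symm
      _ ≤ _ := by gcongr
  · rw [gibbsDensity_apply, gibbsDensity_apply, ← sub_div, abs_div, abs_of_pos hZ, div_le_iff₀ hZ]
    calc _ ≤ exp ‖K‖ * |-V x - -V y| :=
          abs_exp_sub_exp_le ((neg_le_abs _).trans (hV x)) ((neg_le_abs _).trans (hV y))
      _ = exp ‖K‖ * |V x - V y| := by rw [neg_sub_neg, abs_sub_comm]
      _ ≤ exp ‖K‖ * ‖K.curry x - K.curry y‖ := by gcongr; exact hd x y
      _ = exp (2 * ‖K‖) * ‖K.curry x - K.curry y‖ * exp (-‖K‖) := by rw [← e2]; ring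
      _ ≤ _ := by gcongr
  · simp only [Set.mem_ofPred_eq, gibbsDensity_apply]
    rw [integral_div, div_self hZ.ne']

/-- The free energy `∫ ρ log ρ + ½ ∬ K(x, y) ρ(x) ρ(y)`. -/
noncomputable def freeEnergy (K : C(X × X, ℝ)) (ρ : C(X, ℝ)) : ℝ :=
  ∫ x, ρ x * log (ρ x) ∂μ + (∫ x, ρ x * kernelPotential μ K ρ x ∂μ) / 2

lemma continuous_freeEnergy (K : C(X × X, ℝ)) : Continuous (freeEnergy μ K) := by
  have hJ := ContinuousMap.continuous_integral_probability μ
  have h1 : Continuous fun ρ : C(X, ℝ) =>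
      (⟨fun x => x * log x, continuous_mul_log⟩ : C(ℝ, ℝ)).comp ρ :=
    ContinuousMap.continuous_postcomp _
  have h2 : Continuous fun ρ : C(X, ℝ) => ρ * kernelPotential μ K ρ :=
    continuous_id.mul (continuous_kernelPotential μ K)
  exact (hJ.comp h1).add ((hJ.comp h2).div_const 2)

lemma mul_log_sub_mul_log_le {r s : ℝ} (hr : 0 < r) (hs : 0 < s) :
    s * log s - r * log r ≤ (s - r) * (log r + 1) + (s - r) ^ 2 / r := by
  have h : log s ≤ log r + (s - r) / r := by
    have := log_le_sub_one_of_pos (div_pos hs hr)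
    rw [log_div hs.ne' hr.ne'] at this
    have e : (s - r) / r = s / r - 1 := by field_simp
    linarith
  have h' := mul_le_mul_of_nonneg_left h hs.le
  have e : s * ((s - r) / r) = (s - r) + (s - r) ^ 2 / r := by field_simp; ring
  linarith

lemma freeEnergy_add_smul_le {K : C(X × X, ℝ)} (hK : ∀ x y, K (x, y) = K (y, x))
    {ρ d : C(X, ℝ)} (hρ : ∀ x, 0 < ρ x) {t : ℝ} (ht : ∀ x, 0 < (ρ + t • d) x)
    (hd : ∫ x, d x ∂μ = 0) :
    freeEnergy μ K (ρ + t • d) ≤ freeEnergy μ K ρ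
      + t * ∫ x, d x * (log (ρ x) + kernelPotential μ K ρ x) ∂μ
      + t ^ 2 * (∫ x, d x ^ 2 / ρ x ∂μ + (∫ x, d x * kernelPotential μ K d x ∂μ) / 2) := by
  have hne : ∀ x, ρ x ≠ 0 := fun x => (hρ x).ne'
  have int {f : X → ℝ} (hf : Continuous f) : Integrable f μ :=
    hf.integrable_of_hasCompactSupport (HasCompactSupport.of_compactSpace _)
  have hlog : Continuous fun x => log (ρ x) := ρ.continuous.log hne
  have hml : Continuous fun x => ρ x * log (ρ x) := by fun_prop
  have hml' : Continuous fun x => (ρ + t • d) x * log ((ρ + t • d) x) :=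
    continuous_mul_log.comp (ρ + t • d).continuous
  have hq : Continuous fun x => d x ^ 2 / ρ x := (by fun_prop : Continuous fun x => d x ^ 2).div
    ρ.continuous hne
  have hent : ∫ x, (ρ + t • d) x * log ((ρ + t • d) x) ∂μ ≤
      ∫ x, ρ x * log (ρ x) ∂μ + t * ∫ x, d x * log (ρ x) ∂μ + t ^ 2 * ∫ x, d x ^ 2 / ρ x ∂μ := by
    have hle := integral_mono (μ := μ) (int hml')
      (int (f := fun x => ρ x * log (ρ x) + t * (d x * log (ρ x)) + t * d x
        + t ^ 2 * (d x ^ 2 / ρ x)) (by fun_prop)) (fun x => by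
        have := mul_log_sub_mul_log_le (hρ x) (ht x)
        have e : (ρ + t • d) x - ρ x = t * d x := by simp
        rw [e] at this
        have e2 : (t * d x) ^ 2 / ρ x = t ^ 2 * (d x ^ 2 / ρ x) := by ring
        rw [e2] at this
        simp only
        linarith)
    rw [integral_add (int (by fun_prop)) (int (by fun_prop)),
      integral_add (int (by fun_prop)) (int (by fun_prop)),
      integral_add (int (by fun_prop)) (int (by fun_prop)),
      integral_const_mul, integral_const_mul, integral_const_mul, hd] at hle
    linarith
  have hint : ∫ x, (ρ + t • d) x * kernelPotential μ K (ρ + t • d) x ∂μ =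
      ∫ x, ρ x * kernelPotential μ K ρ x ∂μ + 2 * t * ∫ x, d x * kernelPotential μ K ρ x ∂μ
        + t ^ 2 * ∫ x, d x * kernelPotential μ K d x ∂μ := by
    have hs := integral_mul_kernelPotential_comm μ K hK ρ d
    have e : ∀ x, (ρ + t • d) x * kernelPotential μ K (ρ + t • d) x =
        ρ x * kernelPotential μ K ρ x + t * (d x * kernelPotential μ K ρ x)
        + t * (ρ x * kernelPotential μ K d x) + t ^ 2 * (d x * kernelPotential μ K d x) := by
      intro x
      rw [kernelPotential_add_smul]
      simp only [ContinuousMap.add_apply, ContinuousMap.smul_apply, smul_eq_mul]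
      ring
    simp only [e]
    rw [integral_add (int (by fun_prop)) (int (by fun_prop)),
      integral_add (int (by fun_prop)) (int (by fun_prop)),
      integral_add (int (by fun_prop)) (int (by fun_prop)),
      integral_const_mul, integral_const_mul, integral_const_mul, hs]
    ring
  have hlin : ∫ x, d x * (log (ρ x) + kernelPotential μ K ρ x) ∂μ =
      ∫ x, d x * log (ρ x) ∂μ + ∫ x, d x * kernelPotential μ K ρ x ∂μ := by
    simp only [mul_add]
    exact integral_add (int (by fun_prop)) (int (by fun_prop))
  rw [freeEnergy, freeEnergy, hint, hlin]
  linarith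

lemma nonneg_of_forall_mul_add_sq_mul_nonneg {a c : ℝ}
    (h : ∀ t : ℝ, 0 < t → t ≤ 1 → 0 ≤ t * a + t ^ 2 * c) : 0 ≤ a := by
  by_contra! ha
  have hc : 0 < |c| + |a| := by have := abs_pos.2 ha.ne; positivity
  have ha' : |a| = -a := abs_of_neg ha
  set t := |a| / (2 * (|c| + |a|)) with ht
  have htp : 0 < t := div_pos (abs_pos.2 ha.ne) (by positivity)
  have hle : t ≤ 1 := by
    rw [ht, div_le_one (by positivity)]
    have := abs_nonneg c
    have := abs_nonneg a
    linarith
  have h1 := h t htp hle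
  have e : t * (2 * (|c| + |a|)) = |a| := by rw [ht]; field_simp
  have h2 := le_abs_self c
  have h3 : 0 ≤ t * (a + t * c) := by linarith [h1, (by ring : t * (a + t * c) = t * a + t ^ 2 * c)]
  have h4 := nonneg_of_mul_nonneg_right h3 htp
  nlinarith [mul_le_mul_of_nonneg_left h2 htp.le, mul_pos htp (abs_pos.2 ha.ne)]

lemma sub_mul_log_sub_log_nonpos {r s : ℝ} (hr : 0 < r) (hs : 0 < s) :
    (s - r) * (log r - log s) ≤ 0 := by
  rcases le_total r s with h | h
  · exact mul_nonpos_of_nonneg_of_nonpos (sub_nonneg.2 h) (sub_nonpos.2 (log_le_log hr h))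
  · exact mul_nonpos_of_nonpos_of_nonneg (sub_nonpos.2 h) (sub_nonneg.2 (log_le_log hs h))

/-- A symmetric continuous interaction kernel on a compact probability space admits a density that
is the Gibbs density of the potential it generates. -/
theorem exists_ae_eq_gibbsDensity (K : C(X × X, ℝ)) (hK : ∀ x y, K (x, y) = K (y, x)) :
    ∃ ρ : C(X, ℝ), (∀ x, 0 ≤ ρ x) ∧ ∫ x, ρ x ∂μ = 1 ∧
      ρ =ᵐ[μ] gibbsDensity μ (kernelPotential μ K ρ) := by
  set S := controlledDensities μ K (exp (-(2 * ‖K‖))) (exp (2 * ‖K‖)) (exp (2 * ‖K‖))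
  have hne : S.Nonempty :=
    ⟨_, gibbsDensity_mem_controlledDensities (ρ := 1) μ (by simp) (by simp)⟩
  obtain ⟨ρ, hρS, hmin⟩ := (isCompact_controlledDensities μ K _ _ _).exists_isMinOn hne
    (continuous_freeEnergy μ K).continuousOn
  have hpos : ∀ f ∈ S, ∀ x, 0 < f x := fun f hf x => (exp_pos _).trans_le (hf.1.1 x).1
  have hρ := hpos ρ hρS
  have hη := gibbsDensity_mem_controlledDensities (K := K) μ (fun x => (hρ x).le) hρS.2
  have hZ : 0 < ∫ y, exp (-kernelPotential μ K ρ y) ∂μ := (exp_pos _).trans_le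
    (integral_exp_neg_mem_Icc μ (abs_kernelPotential_le (K := K) μ (fun x => (hρ x).le) hρS.2)).1
  have hηdef := gibbsDensity_apply μ (kernelPotential μ K ρ)
  set η := gibbsDensity μ (kernelPotential μ K ρ)
  refine ⟨ρ, fun x => (hρ x).le, hρS.2, ?_⟩
  set Z := ∫ y, exp (-kernelPotential μ K ρ y) ∂μ
  have int {f : X → ℝ} (hf : Continuous f) : Integrable f μ :=
    hf.integrable_of_hasCompactSupport (HasCompactSupport.of_compactSpace _)
  have hd : ∫ x, (η - ρ) x ∂μ = 0 := by
    have h := integral_sub (η.integrable_of_compactSpace μ) (ρ.integrable_of_compactSpace μ)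
    have h1 : ∫ x, η x ∂μ = 1 := hη.2
    have h2 : ∫ x, ρ x ∂μ = 1 := hρS.2
    rw [h1, h2, sub_self] at h
    exact h
  have hvar : 0 ≤ ∫ x, (η - ρ) x * (log (ρ x) + kernelPotential μ K ρ x) ∂μ := by
    refine nonneg_of_forall_mul_add_sq_mul_nonneg (c := ∫ x, (η - ρ) x ^ 2 / ρ x ∂μ +
      (∫ x, (η - ρ) x * kernelPotential μ K (η - ρ) x ∂μ) / 2) fun t h0 h1 => ?_
    have hmem : ρ + t • (η - ρ) ∈ S := by
      have := convex_controlledDensities μ K _ _ _ hρS hη (sub_nonneg.2 h1) h0.le (by ring)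
      convert this using 1
      module
    have h2 := freeEnergy_add_smul_le μ hK hρ (hpos _ hmem) hd
    have h3 : freeEnergy μ K ρ ≤ _ := hmin hmem
    linarith
  have hlogη : ∀ x, kernelPotential μ K ρ x = -log (η x) - log Z := by
    intro x
    rw [hηdef, log_div (exp_pos _).ne' hZ.ne', log_exp]
    ring
  have hηpos := hpos η hη
  have hcρ : Continuous fun x => log (ρ x) := ρ.continuous.log fun x => (hρ x).ne'
  have hcη : Continuous fun x => log (η x) := η.continuous.log fun x => (hηpos x).ne'
  have hsplit : ∫ x, (η - ρ) x * (log (ρ x) + kernelPotential μ K ρ x) ∂μ =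
      -∫ x, -((η x - ρ x) * (log (ρ x) - log (η x))) ∂μ := by
    have e : ∀ x, (η - ρ) x * (log (ρ x) + kernelPotential μ K ρ x) =
        (η x - ρ x) * (log (ρ x) - log (η x)) - log Z * (η - ρ) x := by
      intro x
      rw [hlogη, ContinuousMap.sub_apply]
      ring
    simp only [e]
    rw [integral_sub (int (by fun_prop)) (int (by fun_prop)), integral_const_mul, hd, mul_zero,
      sub_zero, integral_neg, neg_neg]
  have hnn : ∀ x, 0 ≤ -((η x - ρ x) * (log (ρ x) - log (η x))) := fun x =>
    neg_nonneg.2 (sub_mul_log_sub_log_nonpos (hρ x) (hηpos x))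
  have hz : ∫ x, -((η x - ρ x) * (log (ρ x) - log (η x))) ∂μ = 0 :=
    le_antisymm (by linarith) (integral_nonneg hnn)
  rw [integral_eq_zero_iff_of_nonneg hnn (int (by fun_prop))] at hz
  filter_upwards [hz] with x hx
  simp only [Pi.zero_apply, neg_eq_zero, mul_eq_zero, sub_eq_zero] at hx
  rcases hx with h | h
  · exact h.symm
  · exact log_injOn_pos (hρ x) (hηpos x) h

end Gibbs

lemma integral_unitInterval_eq_intervalIntegral (f : ℝ → ℝ) :
    ∫ y : unitInterval, f y = ∫ y in (0 : ℝ)..1, f y := by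
  rw [intervalIntegral.integral_of_le zero_le_one, ← integral_Icc_eq_integral_Ioc]
  exact integral_subtype measurableSet_Icc f

/-- Self-consistent Gibbs density for an even periodic interaction `ψ` and external potential `c`. -/
theorem exists_even_periodic_gibbs {ψ c : ℝ → ℝ} (hψ : Continuous ψ) (hψe : ∀ x, ψ (-x) = ψ x)
    (hψp : ∀ x, ψ (x + 2) = ψ x) (hc : Continuous c) (hce : ∀ x, c (-x) = c x)
    (hcp : ∀ x, c (x + 2) = c x) :
    ∃ (ρ : ℝ → ℝ) (Z : ℝ), Continuous ρ ∧ (∀ x, 0 < ρ x) ∧ IsEvenPeriodicDensity ρ ∧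
      ∀ x, ρ x = exp (-((∫ y in (0 : ℝ)..1, (ψ (x - y) + ψ (x + y)) * ρ y) + c x)) / Z := by
  let K : C(unitInterval × unitInterval, ℝ) :=
    ⟨fun p => ψ (p.1 - p.2) + ψ (p.1 + p.2) + c p.1 + c p.2, by fun_prop⟩
  have hKa : ∀ x y : unitInterval, K (x, y) = ψ (x - y) + ψ (x + y) + c x + c y :=
    fun _ _ => rfl
  obtain ⟨r, hr0, hr1, hr⟩ := exists_ae_eq_gibbsDensity volume K fun x y => by
    rw [hKa, hKa, ← hψe (x - y), neg_sub, add_comm (x : ℝ)]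
    ring
  have int {f : unitInterval → ℝ} (hf : Continuous f) : Integrable f volume :=
    hf.integrable_of_hasCompactSupport (HasCompactSupport.of_compactSpace _)
  let U : ℝ → ℝ := fun x => ∫ y : unitInterval, (ψ (x - y) + ψ (x + y)) * r y
  have hU : Continuous U := by
    have h := continuous_parametric_integral_of_continuous (μ := (volume : Measure unitInterval))
      (f := fun (x : ℝ) (y : unitInterval) => (ψ (x - y) + ψ (x + y)) * r y) (by
        unfold Function.uncurry; fun_prop) isCompact_univ
    simpa only [setIntegral_univ] using h
  let a : ℝ := ∫ y : unitInterval, c y * r y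
  have hV : ∀ x : unitInterval, kernelPotential volume K r x = U x + c x + a := by
    intro x
    have e : ∀ y : unitInterval, K (x, y) * r y =
        (ψ (x - y) + ψ (x + y)) * r y + c x * r y + c y * r y := fun y => by rw [hKa]; ring
    rw [kernelPotential_apply]
    simp only [e]
    rw [integral_add (int (by fun_prop)) (int (by fun_prop)),
      integral_add (int (by fun_prop)) (int (by fun_prop)), integral_const_mul, hr1, mul_one]
  let Z : ℝ := ∫ y in (0 : ℝ)..1, exp (-(U y + c y))
  have hZ : 0 < Z := intervalIntegral.intervalIntegral_pos_of_pos_on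
    (Continuous.intervalIntegrable (by fun_prop) _ _) (fun _ _ => exp_pos _) one_pos
  let ρ : ℝ → ℝ := fun x => exp (-(U x + c x)) / Z
  have hgibbs : ∀ x : unitInterval, gibbsDensity volume (kernelPotential volume K r) x = ρ x := by
    intro x
    have e : ∀ y : unitInterval,
        exp (-kernelPotential volume K r y) = exp (-a) * exp (-(U y + c y)) := fun y => by
      rw [hV, ← exp_add]; ring_nf
    rw [gibbsDensity_apply]
    simp only [e]
    rw [integral_const_mul, integral_unitInterval_eq_intervalIntegral fun y => exp (-(U y + c y)),
      mul_div_mul_left _ _ (exp_pos _).ne']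
  have hUρ : ∀ x, U x = ∫ y in (0 : ℝ)..1, (ψ (x - y) + ψ (x + y)) * ρ y := by
    intro x
    rw [← integral_unitInterval_eq_intervalIntegral fun y => (ψ (x - y) + ψ (x + y)) * ρ y]
    refine integral_congr_ae ?_
    filter_upwards [hr] with y hy
    simp only [hy, hgibbs]
  have hUe : ∀ x, U (-x) = U x := fun x => by
    refine integral_congr_ae (ae_of_all _ fun y => ?_)
    simp only
    rw [← hψe (-x - y), ← hψe (-x + y), add_comm (ψ _)]
    ring_nf
  have hUp : ∀ x, U (x + 2) = U x := fun x => by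
    refine integral_congr_ae (ae_of_all _ fun y => ?_)
    simp only
    rw [← hψp (x - y), ← hψp (x + y)]
    ring_nf
  have hpos : ∀ x, 0 < ρ x := fun x => div_pos (exp_pos _) hZ
  refine ⟨ρ, Z, by fun_prop, hpos, ⟨fun x => ?_, fun x => ?_, fun x => (hpos x).le, ?_⟩, fun x => ?_⟩
  · simp only [ρ, hUp, hcp]
  · simp only [ρ, hUe, hce]
  · simp only [ρ]
    rw [intervalIntegral.integral_div]
    exact div_self hZ.ne'
  · rw [← hUρ]

lemma integral_fold_eq_integral_period {ψ f : ℝ → ℝ} (hψ : Continuous ψ)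
    (hψp : ∀ x, ψ (x + 2) = ψ x) (hf : Continuous f)
    (hfe : ∀ x, f (-x) = f x) (hfp : ∀ x, f (x + 2) = f x) (x : ℝ) :
    ∫ y in (0 : ℝ)..1, (ψ (x - y) + ψ (x + y)) * f y = ∫ y in (x - 1)..(x + 1), ψ (x - y) * f y := by
  have int {g : ℝ → ℝ} (hg : Continuous g) (a b : ℝ) : IntervalIntegrable g volume a b :=
    hg.intervalIntegrable a b
  have hper : Function.Periodic (fun y => ψ (x - y) * f y) 2 := fun y => by
    simp only
    rw [hfp, ← hψp (x - (y + 2))]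
    ring_nf
  have h1 := hper.intervalIntegral_add_eq (x - 1) (-1)
  have e1 : x - 1 + 2 = x + 1 := by ring
  have e2 : (-1 : ℝ) + 2 = 1 := by norm_num
  rw [e1, e2] at h1
  have h2 : ∫ y in (0 : ℝ)..1, ψ (x + y) * f y = ∫ y in (-1 : ℝ)..0, ψ (x - y) * f y := by
    have := intervalIntegral.integral_comp_neg (a := 0) (b := 1) fun y => ψ (x - y) * f y
    simpa [hfe] using this
  rw [h1, ← intervalIntegral.integral_add_adjacent_intervals (a := -1) (b := 0)
    (int (by fun_prop) _ _) (int (by fun_prop) _ _), ← h2,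
    ← intervalIntegral.integral_add (int (by fun_prop) _ _) (int (by fun_prop) _ _)]
  refine intervalIntegral.integral_congr fun y _ => ?_
  ring

/-- The 2-periodic extension of `ξ ↦ min 0 ((ξ² - R²) / 2)`, a potential of the bounded-confidence
kernel. -/
noncomputable def periodicPotential (R ξ : ℝ) : ℝ :=
  min 0 ((‖(ξ : AddCircle (2 : ℝ))‖ ^ 2 - R ^ 2) / 2)

lemma continuous_periodicPotential (R : ℝ) : Continuous (periodicPotential R) := by
  have : Continuous fun ξ : ℝ => (ξ : AddCircle (2 : ℝ)) := AddCircle.continuous_mk' 2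
  unfold periodicPotential
  fun_prop

lemma periodicPotential_neg (R ξ : ℝ) : periodicPotential R (-ξ) = periodicPotential R ξ := by
  simp [periodicPotential]

lemma periodicPotential_add_two (R ξ : ℝ) :
    periodicPotential R (ξ + 2) = periodicPotential R ξ := by
  rw [periodicPotential, AddCircle.coe_add_period, periodicPotential]

lemma periodicPotential_of_abs_le_one (R : ℝ) {ξ : ℝ} (hξ : |ξ| ≤ 1) :
    periodicPotential R ξ = min 0 ((ξ ^ 2 - R ^ 2) / 2) := by
  rw [periodicPotential, (AddCircle.norm_coe_eq_abs_iff (p := 2) two_ne_zero).2 (by simpa using hξ),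
    sq_abs]

lemma integral_periodicPotential_mul {R : ℝ} (hR : 0 < R) (hR1 : R ≤ 1) {f : ℝ → ℝ}
    (hf : Continuous f) (x : ℝ) :
    ∫ y in (x - 1)..(x + 1), periodicPotential R (x - y) * f y =
      ∫ y in (x - R)..(x + R), ((x - y) ^ 2 - R ^ 2) / 2 * f y := by
  have hψ := continuous_periodicPotential R
  have int (a b : ℝ) : IntervalIntegrable (fun y => periodicPotential R (x - y) * f y) volume a b :=
    Continuous.intervalIntegrable (by fun_prop) a b
  have houter : ∀ y, |x - y| ≤ 1 → R ≤ |x - y| → periodicPotential R (x - y) * f y = 0 := by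
    intro y h1 h2
    have : R ^ 2 ≤ (x - y) ^ 2 := by rw [← sq_abs (x - y)]; gcongr
    rw [periodicPotential_of_abs_le_one R h1, min_eq_left (by linarith), zero_mul]
  rw [← intervalIntegral.integral_add_adjacent_intervals (int _ (x - R)) (int _ _),
    ← intervalIntegral.integral_add_adjacent_intervals (int (x - R) (x + R)) (int _ _)]
  have hl : ∫ y in (x - 1)..(x - R), periodicPotential R (x - y) * f y = 0 := by
    refine intervalIntegral.integral_zero_ae (ae_of_all _ fun y hy => ?_)
    rw [Set.uIoc_of_le (by linarith)] at hy
    have : |x - y| = x - y := abs_of_nonneg (by linarith [hy.2])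
    exact houter y (by linarith [hy.1]) (by linarith [hy.2])
  have hr : ∫ y in (x + R)..(x + 1), periodicPotential R (x - y) * f y = 0 := by
    refine intervalIntegral.integral_zero_ae (ae_of_all _ fun y hy => ?_)
    rw [Set.uIoc_of_le (by linarith)] at hy
    have : |x - y| = -(x - y) := abs_of_nonpos (by linarith [hy.1])
    exact houter y (by linarith [hy.2]) (by linarith [hy.1])
  rw [hl, hr, zero_add, add_zero]
  refine intervalIntegral.integral_congr fun y hy => ?_
  rw [Set.uIcc_of_le (by linarith)] at hy
  have h1 : |x - y| ≤ R := abs_le.2 ⟨by linarith [hy.2], by linarith [hy.1]⟩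
  have h2 : (x - y) ^ 2 ≤ R ^ 2 := by rw [← sq_abs (x - y)]; gcongr
  rw [periodicPotential_of_abs_le_one R (h1.trans hR1), min_eq_right (by linarith)]

lemma hasDerivAt_integral_window {f : ℝ → ℝ} (hf : Continuous f) (R x : ℝ) :
    HasDerivAt (fun x => ∫ y in (x - R)..(x + R), f y) (f (x + R) - f (x - R)) x := by
  have hF : ∀ z, HasDerivAt (fun z => ∫ y in (0 : ℝ)..z, f y) (f z) z := fun z =>
    intervalIntegral.integral_hasDerivAt_right (hf.intervalIntegrable _ _)
      hf.stronglyMeasurable.stronglyMeasurableAtFilter hf.continuousAt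
  have h := ((hF (x + R)).comp_add_const x R).sub ((hF (x - R)).comp_sub_const x R)
  refine h.congr_of_eventuallyEq (Filter.Eventually.of_forall fun z => ?_)
  exact (intervalIntegral.integral_interval_sub_left (hf.intervalIntegrable _ _)
    (hf.intervalIntegrable _ _)).symm

lemma contDiff_integral_window {f : ℝ → ℝ} (hf : Continuous f) (R : ℝ) :
    ContDiff ℝ 1 fun x => ∫ y in (x - R)..(x + R), f y := by
  have hd := hasDerivAt_integral_window hf R
  rw [contDiff_one_iff_deriv]
  refine ⟨fun x => (hd x).differentiableAt, ?_⟩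
  rw [funext fun x => (hd x).deriv]
  fun_prop

lemma integral_window_sub_mul {f : ℝ → ℝ} (hf : Continuous f) (R x : ℝ) :
    ∫ y in (x - R)..(x + R), (x - y) * f y =
      x * (∫ y in (x - R)..(x + R), f y) - ∫ y in (x - R)..(x + R), y * f y := by
  rw [← intervalIntegral.integral_const_mul, ← intervalIntegral.integral_sub
    (Continuous.intervalIntegrable (by fun_prop) _ _)
    (Continuous.intervalIntegrable (by fun_prop) _ _)]
  exact intervalIntegral.integral_congr fun y _ => sub_mul _ _ _

lemma hasDerivAt_integral_window_potential {f : ℝ → ℝ} (hf : Continuous f) (R x : ℝ) :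
    HasDerivAt (fun x => ∫ y in (x - R)..(x + R), ((x - y) ^ 2 - R ^ 2) / 2 * f y)
      (∫ y in (x - R)..(x + R), (x - y) * f y) x := by
  have e : (fun x => ∫ y in (x - R)..(x + R), ((x - y) ^ 2 - R ^ 2) / 2 * f y) = fun x =>
      (x ^ 2 - R ^ 2) / 2 * (∫ y in (x - R)..(x + R), f y)
        - x * (∫ y in (x - R)..(x + R), y * f y) + ∫ y in (x - R)..(x + R), y ^ 2 / 2 * f y := by
    funext x
    rw [← intervalIntegral.integral_const_mul, ← intervalIntegral.integral_const_mul,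
      ← intervalIntegral.integral_sub (Continuous.intervalIntegrable (by fun_prop) _ _)
        (Continuous.intervalIntegrable (by fun_prop) _ _),
      ← intervalIntegral.integral_add (Continuous.intervalIntegrable (by fun_prop) _ _)
        (Continuous.intervalIntegrable (by fun_prop) _ _)]
    refine intervalIntegral.integral_congr fun y _ => ?_
    ring
  have h0 := hasDerivAt_integral_window hf R x
  have h1 := hasDerivAt_integral_window (f := fun y => y * f y) (by fun_prop) R x
  have h2 := hasDerivAt_integral_window (f := fun y => y ^ 2 / 2 * f y) (by fun_prop) R x
  have hp : HasDerivAt (fun x : ℝ => (x ^ 2 - R ^ 2) / 2) x x := by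
    have := (((hasDerivAt_id x).pow 2).sub_const (R ^ 2)).div_const 2
    simpa using this
  rw [e, integral_window_sub_mul hf]
  refine (((hp.mul h0).sub ((hasDerivAt_id x).mul h1)).add h2).congr_deriv ?_
  simp only [id]
  ring

theorem stmt_1 (R M σ : ℝ) (hR : 0 < R) (hR1 : R ≤ 1) (hM : 0 ≤ M) (hσ : 0 < σ)
    (ρr : ℝ → ℝ) (hρr : IsEvenPeriodicDensity ρr) (hρrC1 : ContDiff ℝ 1 ρr) :
    ∃ ρs : ℝ → ℝ, ContDiff ℝ 2 ρs ∧ (∀ x, 0 < ρs x) ∧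
      IsEvenPeriodicDensity ρs ∧
      ∀ x : ℝ,
        σ ^ 2 / 2 * deriv (deriv ρs) x
          + deriv (fun y => ρs y * G R M ρs ρr y) x = 0 := by
  obtain ⟨hrp, hre, -, -⟩ := hρr
  have hrc : Continuous ρr := hρrC1.continuous
  have hψ := continuous_periodicPotential R
  have hψp := periodicPotential_add_two R
  have window {f : ℝ → ℝ} (hf : Continuous f) (hfe : ∀ x, f (-x) = f x)
      (hfp : ∀ x, f (x + 2) = f x) (x : ℝ) :=
    (integral_fold_eq_integral_period hψ hψp hf hfe hfp x).trans
      (integral_periodicPotential_mul hR hR1 hf x)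
  set β : ℝ := 2 / σ ^ 2 with hβ
  let c : ℝ → ℝ := fun x => β * M * ∫ y in (0 : ℝ)..1,
    (periodicPotential R (x - y) + periodicPotential R (x + y)) * ρr y
  obtain ⟨ρ, Z, hρc, hρ0, hρd, hρ⟩ := exists_even_periodic_gibbs
    (ψ := fun x => β * periodicPotential R x) (c := c) (by fun_prop)
    (fun x => by simp only [periodicPotential_neg]) (fun x => by simp only [hψp])
    (continuous_const.mul (intervalIntegral.continuous_parametric_intervalIntegral_of_continuous'
      (by unfold Function.uncurry; fun_prop) 0 1))
    (fun x => by
      simp only [c]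
      congr 1
      refine intervalIntegral.integral_congr fun y _ => ?_
      rw [← periodicPotential_neg R (-x - y), ← periodicPotential_neg R (-x + y),
        add_comm (periodicPotential R _)]
      ring_nf)
    (fun x => by
      simp only [c]
      congr 1
      refine intervalIntegral.integral_congr fun y _ => ?_
      rw [← hψp (x - y), ← hψp (x + y)]
      ring_nf)
  let f : ℝ → ℝ := fun y => ρ y + M * ρr y
  have hf : Continuous f := by fun_prop
  let V : ℝ → ℝ := fun x => ∫ y in (x - R)..(x + R), ((x - y) ^ 2 - R ^ 2) / 2 * f y
  have hρV : ρ = fun x => exp (-(β * V x)) / Z := by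
    funext x
    have hw := window hf (fun x => by simp only [f, hρd.2.1, hre])
      (fun x => by simp only [f, hρd.1, hrp]) x
    rw [hρ x]
    congr 3
    simp only [V, c]
    rw [← hw, ← intervalIntegral.integral_const_mul, ← intervalIntegral.integral_const_mul,
      ← intervalIntegral.integral_add (Continuous.intervalIntegrable (by fun_prop) _ _)
        (Continuous.intervalIntegrable (by fun_prop) _ _)]
    refine intervalIntegral.integral_congr fun y _ => ?_
    simp only [f]
    ring
  have hVd : ∀ x, HasDerivAt V (G R M ρ ρr x) x := hasDerivAt_integral_window_potential hf R
  have hG : ContDiff ℝ 1 (G R M ρ ρr) := by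
    have e : G R M ρ ρr = fun x => x * (∫ y in (x - R)..(x + R), f y)
        - ∫ y in (x - R)..(x + R), y * f y := funext (integral_window_sub_mul hf R)
    rw [e]
    exact (contDiff_id.mul (contDiff_integral_window hf R)).sub
      (contDiff_integral_window (by fun_prop) R)
  have hV2 : ContDiff ℝ 2 V := by
    rw [show (2 : WithTop ℕ∞) = 1 + 1 by norm_num, contDiff_succ_iff_deriv]
    refine ⟨fun x => (hVd x).differentiableAt, by simp, ?_⟩
    rwa [funext fun x => (hVd x).deriv]
  have hρ' : deriv ρ = fun x => -β * (ρ x * G R M ρ ρr x) := by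
    funext x
    have h := ((((hVd x).const_mul β).neg).exp.div_const Z).deriv
    have e : ρ x = exp (-(β * V x)) / Z := congrFun hρV x
    calc deriv ρ x = deriv (fun x => exp (-(β * V x)) / Z) x := by rw [← hρV]
      _ = exp (-(β * V x)) * -(β * G R M ρ ρr x) / Z := h
      _ = _ := by rw [e]; ring
  refine ⟨ρ, ?_, hρ0, hρd, fun x => ?_⟩
  · rw [hρV]
    exact ((contDiff_const.mul hV2).neg.exp).div_const Z
  · rw [hρ', deriv_const_mul_field, hβ]
    field_simp
    ring
end
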